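/- Let F be an algebraically closed field of transcendence degree at least 1 over its prime field, and let H be a group of permutations of F ∪ {∞} properly containing PΓL₂(F). Then H is 4-transitive, i.e. H acts transitively on the set of quadruples of distinct elements of F ∪ {∞}. -/

import Mathlib

open scoped Classical

/-- The cross-ratio `[a,b;c,d]` on the projective line `F ∪ {∞}` (modelled as
`Option F`, with `none` playing the role of `∞`), with the usual conventions
at `∞`; junk value `0` when two or more of the arguments are `∞`. -/
noncomputable def crossRatio {F : Type*} [Field F] :
    Option F → Option F → Option F → Option F → F
  | none,   some b, some c, some d => (d - b) / (c - b)
  | some a, none,   some c, some d => (c - a) / (d - a)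
  | some a, some b, none,   some d => (d - b) / (d - a)
  | some a, some b, some c, none   => (c - a) / (c - b)
  | some a, some b, some c, some d => ((c - a) / (c - b)) * ((d - b) / (d - a))
  | _, _, _, _ => 0

/-- A permutation `f` of the projective line is `O`-preserving if for all
quadruples of distinct points, `[a,b;c,d] ∈ O ↔ [f a, f b; f c, f d] ∈ O`. -/
def OPreserving {F : Type*} [Field F] (O : Set F) (f : Equiv.Perm (Option F)) : Prop :=
  ∀ a b c d : Option F, a ≠ b → a ≠ c → a ≠ d → b ≠ c → b ≠ d → c ≠ d →
    (crossRatio a b c d ∈ O ↔ crossRatio (f a) (f b) (f c) (f d) ∈ O)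

/-- The map `x ↦ (a σ(x) + b)/(c σ(x) + d)` on the projective line `F ∪ {∞}`,
with the usual conventions at `∞`. -/
noncomputable def moebius {F : Type*} [Field F] (σ : F ≃+* F) (a b c d : F) :
    Option F → Option F
  | none => if c = 0 then none else some (a / c)
  | some x => if c * σ x + d = 0 then none else some ((a * σ x + b) / (c * σ x + d))

/-- `PΓL₂(F)`: the group of permutations of the projective line `F ∪ {∞}` of the
form `x ↦ (a σ(x) + b)/(c σ(x) + d)` with `ad - bc ≠ 0` and `σ ∈ Aut(F)`. -/
def PGammaL2 (F : Type*) [Field F] : Set (Equiv.Perm (Option F)) :=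
  {f | ∃ (σ : F ≃+* F) (a b c d : F), a * d - b * c ≠ 0 ∧
        ∀ x, f x = moebius σ a b c d x}

/-- A `K`-chain: the image of `K ∪ {∞}` under an element of `PΓL₂(F)`. -/
def IsKChain {F : Type*} [Field F] (K : Subfield F) (X : Set (Option F)) : Prop :=
  ∃ g ∈ PGammaL2 F, X = ⇑g '' (some '' (K : Set F) ∪ {none})

/-- In an algebraically closed field, any two elements transcendental over a subfield are
conjugate under a field automorphism. -/
theorem exists_ringEquiv_apply_eq_of_transcendental {k F : Type*} [Field k] [Field F] [Algebra k F]
    [IsAlgClosed F] {s t : F} (hs : Transcendental k s) (ht : Transcendental k t) :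
    ∃ σ : F ≃+* F, σ s = t := by
  obtain ⟨S, hsS, hS⟩ := exists_isTranscendenceBasis_superset (R := k) (s := {s})
    (algebraicIndependent_unique_type_iff.mpr hs)
  obtain ⟨T, htT, hT⟩ := exists_isTranscendenceBasis_superset (R := k) (s := {t})
    (algebraicIndependent_unique_type_iff.mpr ht)
  obtain ⟨e₀⟩ := Cardinal.eq.mp (hS.cardinalMk_eq hT)
  let s' : S := ⟨s, hsS rfl⟩
  let t' : T := ⟨t, htT rfl⟩
  let e : S ≃ T := e₀.trans (Equiv.swap (e₀ s') t')
  have he : e s' = t' := by simp [e]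
  let := IsAlgClosed.isAlgClosure_of_transcendence_basis _ hS
  let := IsAlgClosed.isAlgClosure_of_transcendence_basis _ hT
  let φ : Algebra.adjoin k (Set.range ((↑) : S → F)) ≃+*
      Algebra.adjoin k (Set.range ((↑) : T → F)) :=
    ((hS.1.aevalEquiv.symm.trans (MvPolynomial.renameEquiv k e)).trans
      hT.1.aevalEquiv).toRingEquiv
  refine ⟨IsAlgClosure.equivOfEquiv F F φ, ?_⟩
  have h1 : s = algebraMap (Algebra.adjoin k (Set.range ((↑) : S → F))) F
      (hS.1.aevalEquiv (MvPolynomial.X s')) := by simp [s']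
  rw [h1, IsAlgClosure.equivOfEquiv_algebraMap]
  simp [φ, he, t']

/-- The permutation of `α` induced by a permutation of `Option α` fixing `none`. -/
theorem exists_equiv_of_apply_none {α : Type*} {h : Equiv.Perm (Option α)} (hn : h none = none) :
    ∃ f : α ≃ α, ∀ x, h (some x) = some (f x) :=
  ⟨Equiv.removeNone h, fun x => (Equiv.removeNone_some h (Option.ne_none_iff_exists'.mp
    fun h' => Option.some_ne_none x (h.injective (h'.trans hn.symm)))).symm⟩

section Moebius

variable {F : Type*} [Field F]

theorem moebius_adjugate_moebius {a b c d : F} (h : a * d - b * c ≠ 0) (x : Option F) :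
    moebius (RingEquiv.refl F) d (-b) (-c) a (moebius (RingEquiv.refl F) a b c d x) = x := by
  rcases x with _ | x
  · by_cases hc : c = 0
    · simp [moebius, hc]
    · have : -(c * (a / c)) + a = 0 := by field_simp; ring
      simp [moebius, hc, this]
  · by_cases hx : c * x + d = 0
    · have hc : c ≠ 0 := by
        rintro rfl
        apply h
        have : d = 0 := by simpa using hx
        simp [this]
      have : -(d / c) = x := by field_simp; linear_combination -hx
      simp [moebius, hx, hc, div_neg, this]
    · have h1 : -(c * ((a * x + b) / (c * x + d))) + a = (a * d - b * c) / (c * x + d) := by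
        field_simp; ring
      have h2 : (d * ((a * x + b) / (c * x + d)) + -b) = (a * d - b * c) * x / (c * x + d) := by
        rw [eq_div_iff hx, add_mul, mul_assoc, div_mul_cancel₀ _ hx]; ring
      have h3 : (a * d - b * c) * x / (c * x + d) / ((a * d - b * c) / (c * x + d)) = x := by
        field_simp
      simp [moebius, hx, h1, h2, h3, h]

/-- The fractional linear permutation `x ↦ (ax + b)/(cx + d)` of the projective line. -/
noncomputable def moebiusPerm (a b c d : F) (h : a * d - b * c ≠ 0) :
    Equiv.Perm (Option F) where
  toFun := moebius (RingEquiv.refl F) a b c d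
  invFun := moebius (RingEquiv.refl F) d (-b) (-c) a
  left_inv := moebius_adjugate_moebius h
  right_inv x := by
    have h' : d * a - -b * -c ≠ 0 := by rwa [neg_mul_neg, mul_comm d]
    simpa using moebius_adjugate_moebius h' x

theorem moebiusPerm_apply {a b c d : F} (h : a * d - b * c ≠ 0) (x : Option F) :
    moebiusPerm a b c d h x = moebius (RingEquiv.refl F) a b c d x := rfl

theorem moebiusPerm_mem_PGammaL2 {a b c d : F} (h : a * d - b * c ≠ 0) :
    moebiusPerm a b c d h ∈ PGammaL2 F :=
  ⟨RingEquiv.refl F, a, b, c, d, h, fun _ => rfl⟩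

theorem optionCongr_mem_PGammaL2 (σ : F ≃+* F) :
    Equiv.optionCongr σ.toEquiv ∈ PGammaL2 F := by
  refine ⟨σ, 1, 0, 0, 1, by simp, fun x => ?_⟩
  cases x <;> simp [moebius]

theorem moebiusPerm_mem_subfield {A : Subfield F} {a b c d : F} (h : a * d - b * c ≠ 0)
    (ha : a ∈ A) (hb : b ∈ A) (hc : c ∈ A) (hd : d ∈ A) {x : Option F}
    (hx : ∀ u, x = some u → u ∈ A) {v : F} (hv : moebiusPerm a b c d h x = some v) : v ∈ A := by
  rw [moebiusPerm_apply] at hv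
  rcases x with _ | x
  · by_cases h0 : c = 0
    · simp [moebius, h0] at hv
    · simp only [moebius, h0, if_false, Option.some.injEq] at hv
      exact hv ▸ A.div_mem ha hc
  · have hx := hx x rfl
    by_cases h0 : c * x + d = 0
    · simp [moebius, h0] at hv
    · simp only [moebius, RingEquiv.refl_apply, h0, if_false, Option.some.injEq] at hv
      exact hv ▸ A.div_mem (A.add_mem (A.mul_mem ha hx) hb) (A.add_mem (A.mul_mem hc hx) hd)

theorem exists_moebiusPerm_apply_eq (A : Subfield F) {x y z : Option F}
    (hx : ∀ u, x = some u → u ∈ A) (hy : ∀ u, y = some u → u ∈ A)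
    (hz : ∀ u, z = some u → u ∈ A) (hxy : x ≠ y) (hxz : x ≠ z) (hyz : y ≠ z) :
    ∃ (a b c d : F) (h : a * d - b * c ≠ 0), (a ∈ A ∧ b ∈ A ∧ c ∈ A ∧ d ∈ A) ∧
      moebiusPerm a b c d h none = x ∧ moebiusPerm a b c d h (some 0) = y ∧
      moebiusPerm a b c d h (some 1) = z := by
  simp only [moebiusPerm_apply]
  rcases x with _ | x
  · rcases y with _ | y
    · exact absurd rfl hxy
    rcases z with _ | z
    · exact absurd rfl hxz
    have hyA := hy y rfl
    have hzA := hz z rfl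
    have hyz : z - y ≠ 0 := sub_ne_zero.mpr fun h => hyz (by rw [h])
    exact ⟨z - y, y, 0, 1, by simpa, ⟨A.sub_mem hzA hyA, hyA, A.zero_mem, A.one_mem⟩,
      by simp [moebius]⟩
  have hxA := hx x rfl
  rcases y with _ | y
  · rcases z with _ | z
    · exact absurd rfl hyz
    have hzA := hz z rfl
    have hxz : z - x ≠ 0 := sub_ne_zero.mpr fun h => hxz (by rw [h])
    exact ⟨x, z - x, 1, 0, by simpa [sub_eq_zero, eq_comm] using hxz,
      ⟨hxA, A.sub_mem hzA hxA, A.one_mem, A.zero_mem⟩, by simp [moebius]⟩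
  have hyA := hy y rfl
  have hxy : y - x ≠ 0 := sub_ne_zero.mpr fun h => hxy (by rw [h])
  rcases z with _ | z
  · refine ⟨-x, y, -1, 1, ?_, ⟨A.neg_mem hxA, hyA, A.neg_mem A.one_mem, A.one_mem⟩,
      by simp [moebius]⟩
    convert hxy using 1; ring
  have hzA := hz z rfl
  have hxz : z - x ≠ 0 := sub_ne_zero.mpr fun h => hxz (by rw [h])
  have hyz : y - z ≠ 0 := sub_ne_zero.mpr fun h => hyz (by rw [h])
  refine ⟨x * (y - z), y * (z - x), y - z, z - x, ?_,
    ⟨A.mul_mem hxA (A.sub_mem hyA hzA), A.mul_mem hyA (A.sub_mem hzA hxA), A.sub_mem hyA hzA,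
      A.sub_mem hzA hxA⟩, ?_, ?_, ?_⟩
  · have : x * (y - z) * (z - x) - y * (z - x) * (y - z) = -((y - x) * (z - x) * (y - z)) := by
      ring
    rw [this]
    exact neg_ne_zero.mpr (mul_ne_zero (mul_ne_zero hxy hxz) hyz)
  · simp [moebius, hyz]
  · simp [moebius, hxz]
  · have h1 : y - z + (z - x) = y - x := by ring
    have h2 : x * (y - z) + y * (z - x) = z * (y - x) := by ring
    simp [moebius, hxy, h1, h2]

theorem exists_moebiusPerm_apply_eq_of_ne {x y z : Option F}
    (hxy : x ≠ y) (hxz : x ≠ z) (hyz : y ≠ z) :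
    ∃ (a b c d : F) (h : a * d - b * c ≠ 0),
      moebiusPerm a b c d h none = x ∧ moebiusPerm a b c d h (some 0) = y ∧
      moebiusPerm a b c d h (some 1) = z := by
  obtain ⟨a, b, c, d, h, -, h'⟩ := exists_moebiusPerm_apply_eq (⊤ : Subfield F)
    (x := x) (y := y) (z := z) (by simp) (by simp) (by simp) hxy hxz hyz
  exact ⟨a, b, c, d, h, h'⟩

end Moebius

section Additive

variable {F : Type*} [Field F]

/-- `f` maps affine lines over the subfield `L` into affine lines over `L`. -/
def MapsLines (L : Subfield F) (f : F → F) : Prop :=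
  ∀ a b : F, ∀ s ∈ L, ∃ t ∈ L, f (a + s * (b - a)) = f a + t * (f b - f a)

theorem MapsLines.apply_mul {L : Subfield F} {f : F → F} (hf : MapsLines L f) (h0 : f 0 = 0)
    {s : F} (hs : s ∈ L) (x : F) : ∃ t ∈ L, f (s * x) = t * f x := by
  simpa [h0] using hf 0 x s hs

/-- A bijection mapping lines to lines preserves parallelism, in coordinates. -/
theorem MapsLines.coeff_eq_one {L : Subfield F} {f : F ≃ F} (hg : MapsLines L f.symm)
    (h0 : f 0 = 0) {x y A B : F} (hA : A ∈ L) (hB : B ∈ L) (hxy : ∀ s ∈ L, y ≠ s * x)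
    (h : f (x + y) = A * f x + B * f y) : B = 1 := by
  by_contra hB1
  have hB1' : 1 - B ≠ 0 := sub_ne_zero.mpr (Ne.symm hB1)
  have hτ : (1 - B)⁻¹ ∈ L := L.inv_mem (L.sub_mem L.one_mem hB)
  obtain ⟨s, hs, h1⟩ := hg (f y) (f (x + y)) _ hτ
  obtain ⟨s', hs', h2⟩ := hg.apply_mul (by rw [Equiv.symm_apply_eq, h0])
    (L.mul_mem hτ hA) (f x)
  have h3 : f y + (1 - B)⁻¹ * (f (x + y) - f y) = (1 - B)⁻¹ * A * f x := by
    rw [h]; field_simp; ring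
  rw [h3, h2] at h1
  simp only [Equiv.symm_apply_apply] at h1
  exact hxy (s' - s) (L.sub_mem hs' hs) (by linear_combination -h1)

theorem MapsLines.map_add_of_div_notMem {L : Subfield F} {f : F ≃ F} (hf : MapsLines L f)
    (hg : MapsLines L f.symm) (h0 : f 0 = 0) {u : F} (hu : u ∈ L) (hu0 : u ≠ 0) (hu1 : u ≠ 1)
    {x y : F} (hxy : y / x ∉ L) : f (x + y) = f x + f y := by
  have hx : x ≠ 0 := by rintro rfl; simp [L.zero_mem] at hxy
  have hy : y ≠ 0 := by rintro rfl; simp [L.zero_mem] at hxy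
  have hu1' : 1 - u ≠ 0 := sub_ne_zero.mpr (Ne.symm hu1)
  obtain ⟨p, hp, h1⟩ := hf.apply_mul h0 (L.inv_mem hu) x
  obtain ⟨q, hq, h2⟩ := hf.apply_mul h0 (L.inv_mem (L.sub_mem L.one_mem hu)) y
  obtain ⟨r, hr, h3⟩ := hf ((1 - u)⁻¹ * y) (u⁻¹ * x) u hu
  have h4 : (1 - u)⁻¹ * y + u * (u⁻¹ * x - (1 - u)⁻¹ * y) = x + y := by field_simp; ring
  rw [h4, h1, h2] at h3
  have hA : r * p ∈ L := L.mul_mem hr hp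
  have hB : (1 - r) * q ∈ L := L.mul_mem (L.sub_mem L.one_mem hr) hq
  have h5 : f (x + y) = (r * p) * f x + ((1 - r) * q) * f y := by rw [h3]; ring
  have hB1 := hg.coeff_eq_one (x := x) (y := y) h0 hA hB
    (fun s hs h => hxy (by rw [h, mul_div_cancel_right₀ _ hx]; exact hs)) h5
  have hA1 := hg.coeff_eq_one (x := y) (y := x) h0 hB hA
    (fun s hs h => hxy (by
      rw [← inv_div, h, mul_div_cancel_right₀ _ hy]; exact L.inv_mem hs))
    (by rw [add_comm y x, h5]; ring)
  rw [h5, hA1, hB1, one_mul, one_mul]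

/-- A form of the fundamental theorem of affine geometry: a bijection of `F` fixing `0` and
mapping lines to lines in both directions is additive. -/
theorem MapsLines.map_add {L : Subfield F} {f : F ≃ F} (hf : MapsLines L f)
    (hg : MapsLines L f.symm) (h0 : f 0 = 0) {u : F} (hu : u ∈ L) (hu0 : u ≠ 0) (hu1 : u ≠ 1)
    {t : F} (ht : t ∉ L) (x y : F) : f (x + y) = f x + f y := by
  have key : ∀ {x y : F}, y / x ∉ L → f (x + y) = f x + f y := fun h =>
    hf.map_add_of_div_notMem hg h0 hu hu0 hu1 h
  by_cases hxy : y / x ∉ L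
  · exact key hxy
  push Not at hxy
  by_cases hx : x = 0
  · simp [hx, h0]
  by_cases hy : y = 0
  · simp [hy, h0]
  have aux : ∀ {v : F}, v ∈ L → v ≠ 0 → t * x / (v * x) ∉ L := fun {v} hv hv0 h => ht (by
    have : t = t * x / (v * x) * v := by field_simp
    rw [this]; exact L.mul_mem h hv)
  obtain ⟨s, hs⟩ : ∃ s, s = y / x := ⟨_, rfl⟩
  rw [← hs] at hxy
  have hys : y = s * x := by rw [hs]; field_simp
  have hs0 : s ≠ 0 := by rintro rfl; exact hy (by simp [hys])
  have e1 : f (y + t * x) = f y + f (t * x) := key (by rw [hys]; exact aux hxy hs0)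
  have e2 : f (x + (y + t * x)) = f x + f (y + t * x) := key fun h => ht (by
    have : t = (y + t * x) / x - s := by rw [hys]; field_simp; ring
    rw [this]; exact L.sub_mem h hxy)
  have e3 : f ((x + y) + t * x) = f (x + y) + f (t * x) := by
    by_cases h1 : 1 + s = 0
    · have : x + y = 0 := by rw [hys]; linear_combination x * h1
      simp [this, h0]
    · refine key ?_
      have : x + y = (1 + s) * x := by rw [hys]; ring
      rw [this]
      exact aux (L.add_mem L.one_mem hxy) h1
  rw [add_assoc, e2, e1] at e3
  linear_combination -e3

/-- A Hua-type argument: additive maps intertwined by inversion are multiplicative, provided every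
element is a square. -/
theorem map_mul_of_map_inv {f g : F → F} (hsq : ∀ x : F, ∃ y, y ^ 2 = x)
    (hf : ∀ x y, f (x + y) = f x + f y) (hg : ∀ x y, g (x + y) = g x + g y)
    (hg1 : g 1 = 1) (hg0 : ∀ x, g x = 0 → x = 0) (hfg : ∀ x, f x⁻¹ = (g x)⁻¹) (x y : F) :
    g (x * y) = g x * g y := by
  have g0 : g 0 = 0 := by simpa using hg 0 0
  have key : ∀ x a, x ≠ 0 → a ≠ 0 → g (x ^ 2 * a⁻¹) = g x ^ 2 * (g a)⁻¹ := by
    intro x a hx ha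
    have hgx : g x ≠ 0 := fun h => hx (hg0 x h)
    have hga : g a ≠ 0 := fun h => ha (hg0 a h)
    by_cases hxa : x + a = 0
    · have h1 : g x + g a = 0 := by rw [← hg, hxa, g0]
      have h2 : x ^ 2 * a⁻¹ = a := by
        rw [eq_neg_of_add_eq_zero_left hxa]; field_simp
      rw [h2, eq_neg_of_add_eq_zero_left h1]; field_simp
    · have hgxa : g x + g a ≠ 0 := by rw [← hg]; exact fun h => hxa (hg0 _ h)
      have h1 : x⁻¹ = (x + a)⁻¹ + (x ^ 2 * a⁻¹ + x)⁻¹ := by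
        have : x ^ 2 * a⁻¹ + x = x * (x + a) * a⁻¹ := by field_simp
        rw [this]; field_simp
      have h2 := congrArg f h1
      rw [hf, hfg, hfg, hfg, hg, hg] at h2
      have h3 : (g (x ^ 2 * a⁻¹) + g x)⁻¹ = g a * (g x * (g x + g a))⁻¹ := by
        rw [← sub_eq_iff_eq_add'] at h2
        rw [← h2]; field_simp; ring
      have h4 : g (x ^ 2 * a⁻¹) + g x = g x * (g x + g a) * (g a)⁻¹ := by
        rw [← inv_inv (g _ + g x), h3, mul_inv, inv_inv, mul_comm]
      rw [eq_sub_of_add_eq h4]; field_simp; ring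
  have key2 : ∀ x, g (x ^ 2) = g x ^ 2 := by
    intro x
    by_cases hx : x = 0
    · simp [hx, g0]
    · simpa [hg1] using key x 1 hx one_ne_zero
  by_cases hx : x = 0
  · simp [hx, g0]
  by_cases hy : y = 0
  · simp [hy, g0]
  obtain ⟨z, rfl⟩ := hsq x
  have hz : z ≠ 0 := by rintro rfl; simp at hx
  have hinv : g y⁻¹ = (g y)⁻¹ := by simpa [hg1] using key 1 y one_ne_zero hy
  simpa [key2, hinv] using key z y⁻¹ hz (inv_ne_zero hy)

end Additive

section Closure

variable {F : Type*} [Field F]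

/-- No element of `H` maps `(a, b, c)` to `(∞, 0, 1)` and `d` to an element of `F` outside `A`. -/
def OrbitIn (H : Subgroup (Equiv.Perm (Option F))) (A : Subfield F) (a b c d : Option F) : Prop :=
  a ≠ b ∧ a ≠ c ∧ b ≠ c ∧ ∀ h ∈ H, h a = none → h b = some 0 → h c = some 1 →
    ∀ t, h d = some t → t ∈ A

theorem OrbitIn.map {H : Subgroup (Equiv.Perm (Option F))} {A : Subfield F} {a b c d : Option F}
    (hq : OrbitIn H A a b c d) {g : Equiv.Perm (Option F)} (hg : g ∈ H) :
    OrbitIn H A (g a) (g b) (g c) (g d) := by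
  obtain ⟨hab, hac, hbc, hq⟩ := hq
  refine ⟨g.injective.ne hab, g.injective.ne hac, g.injective.ne hbc, fun h hh => ?_⟩
  simpa using hq (h * g) (H.mul_mem hh hg)

/-- The closure of `{∞, 0, 1}` under completing triples to quadruples satisfying `OrbitIn`. -/
inductive QuadClosure (H : Subgroup (Equiv.Perm (Option F))) (A : Subfield F) : Option F → Prop
  | infty : QuadClosure H A none
  | zero : QuadClosure H A (some 0)
  | one : QuadClosure H A (some 1)
  | step {a b c d : Option F} : QuadClosure H A a → QuadClosure H A b → QuadClosure H A c →
      OrbitIn H A a b c d → QuadClosure H A d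

variable {H : Subgroup (Equiv.Perm (Option F))} {A : Subfield F}

theorem QuadClosure.map {x : Option F} (hx : QuadClosure H A x) {h : Equiv.Perm (Option F)}
    (hh : h ∈ H) (h1 : QuadClosure H A (h none)) (h2 : QuadClosure H A (h (some 0)))
    (h3 : QuadClosure H A (h (some 1))) : QuadClosure H A (h x) := by
  induction hx with
  | infty => exact h1
  | zero => exact h2
  | one => exact h3
  | step _ _ _ hq ha hb hc => exact .step ha hb hc (hq.map hh)

theorem QuadClosure.mem_subfield (hP : PGammaL2 F ⊆ (H : Set (Equiv.Perm (Option F))))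
    {x : Option F} (hx : QuadClosure H A x) : ∀ u, x = some u → u ∈ A := by
  induction hx with
  | infty => simp
  | zero => rintro u ⟨⟩; exact A.zero_mem
  | one => rintro u ⟨⟩; exact A.one_mem
  | @step a b c d _ _ _ hq ha hb hc =>
    obtain ⟨hab, hac, hbc, hq⟩ := hq
    obtain ⟨p, q, r, s, hdet, ⟨hp, hq', hr, hs⟩, e1, e2, e3⟩ :=
      exists_moebiusPerm_apply_eq A ha hb hc hab hac hbc
    intro u hu
    refine moebiusPerm_mem_subfield hdet hp hq' hr hs
      (x := (moebiusPerm p q r s hdet)⁻¹ d) ?_ (by simpa using hu)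
    exact hq _ (H.inv_mem (hP (moebiusPerm_mem_PGammaL2 hdet))) (by simp [← e1]) (by simp [← e2])
      (by simp [← e3])

/-- If `L` contains `0`, `1` and a further element, and is stable under inversion and under the
affine maps taking `0`, `1` to distinct elements of `L`, then `L` is a subfield. -/
theorem exists_subfield_of_affine_closed (L : Set F) (h0 : (0 : F) ∈ L) (h1 : (1 : F) ∈ L)
    {l : F} (hl : l ∈ L) (hl0 : l ≠ 0) (hl1 : l ≠ 1)
    (haff : ∀ u ∈ L, ∀ v ∈ L, u ≠ v → ∀ x ∈ L, (v - u) * x + u ∈ L)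
    (hinv : ∀ x ∈ L, x ≠ 0 → x⁻¹ ∈ L) : ∃ K : Subfield F, (K : Set F) = L := by
  have hinv' : ∀ x ∈ L, x⁻¹ ∈ L := fun x hx => by
    by_cases h : x = 0
    · simpa [h] using h0
    · exact hinv x hx h
  have hmul : ∀ x ∈ L, ∀ y ∈ L, x * y ∈ L := fun x hx y hy => by
    by_cases h : x = 0
    · simpa [h] using h0
    · simpa using haff 0 h0 x hx (Ne.symm h) y hy
  have hsub : ∀ a ∈ L, a ≠ 0 → ∀ x ∈ L, a - x ∈ L := fun a ha ha0 x hx => by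
    have := haff a ha 0 h0 ha0 _ (hmul x hx _ (hinv' a ha))
    have e : (0 - a) * (x * a⁻¹) + a = a - x := by field_simp; ring
    rwa [e] at this
  have hneg : ∀ x ∈ L, -x ∈ L := fun x hx => by
    obtain ⟨a, ha, ha0, hax⟩ : ∃ a ∈ L, a ≠ 0 ∧ a ≠ x := by
      by_cases hx1 : 1 = x
      · exact ⟨l, hl, hl0, hx1 ▸ hl1⟩
      · exact ⟨1, h1, one_ne_zero, hx1⟩
    simpa using hsub (a - x) (hsub a ha ha0 x hx) (sub_ne_zero.mpr hax) a ha
  have hadd : ∀ x ∈ L, ∀ y ∈ L, x + y ∈ L := fun x hx y hy => by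
    by_cases h : x = 0
    · simpa [h] using hy
    · simpa using hsub x hx h (-y) (hneg y hy)
  exact ⟨{ carrier := L
           mul_mem' := fun hx hy => hmul _ hx _ hy
           one_mem' := h1
           add_mem' := fun hx hy => hadd _ hx _ hy
           zero_mem' := h0
           neg_mem' := fun hx => hneg _ hx
           inv_mem' := hinv' }, rfl⟩

/-- If some quadruple of distinct points satisfies `OrbitIn`, then there is a subfield of `A` of
order at least `3` stable under the elements of `H` fixing `∞`, `0` and `1`. -/
theorem exists_stable_subfield (hP : PGammaL2 F ⊆ (H : Set (Equiv.Perm (Option F))))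
    {a b c d : Option F} (hq : OrbitIn H A a b c d) (had : a ≠ d) (hbd : b ≠ d) (hcd : c ≠ d) :
    ∃ L : Subfield F, L ≤ A ∧ (∃ u ∈ L, u ≠ 0 ∧ u ≠ 1) ∧
      ∀ h ∈ H, h none = none → h (some 0) = some 0 → h (some 1) = some 1 →
        ∀ x ∈ L, ∃ y ∈ L, h (some x) = some y := by
  obtain ⟨l, hl, hl0, hl1⟩ : ∃ l : F, QuadClosure H A (some l) ∧ l ≠ 0 ∧ l ≠ 1 := by
    obtain ⟨p, q, r, s, hdet, e1, e2, e3⟩ := exists_moebiusPerm_apply_eq_of_ne hq.1 hq.2.1 hq.2.2.1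
    set m := moebiusPerm p q r s hdet
    obtain ⟨y, rfl⟩ := m.surjective d
    have hq' := hq.map (H.inv_mem (hP (moebiusPerm_mem_PGammaL2 hdet)))
    change OrbitIn H A (m⁻¹ _) (m⁻¹ _) (m⁻¹ _) (m⁻¹ _) at hq'
    simp only [← e1, ← e2, ← e3, ← Equiv.Perm.mul_apply, inv_mul_cancel, Equiv.Perm.one_apply] at hq'
    rw [← e1, m.injective.ne_iff] at had
    rw [← e2, m.injective.ne_iff] at hbd
    rw [← e3, m.injective.ne_iff] at hcd
    obtain ⟨l, rfl⟩ := Option.ne_none_iff_exists'.mp had.symm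
    exact ⟨l, .step .infty .zero .one hq', fun h => hbd (by rw [h]), fun h => hcd (by rw [h])⟩
  obtain ⟨L, hL⟩ := exists_subfield_of_affine_closed {x : F | QuadClosure H A (some x)}
    .zero .one hl hl0 hl1
    (fun u hu v hv huv x hx => by
      have hdet : (v - u) * 1 - u * 0 ≠ 0 := by simpa [sub_eq_zero] using huv.symm
      have := QuadClosure.map hx (hP (moebiusPerm_mem_PGammaL2 hdet))
      simp only [moebiusPerm_apply, moebius] at this
      simpa using this (by simpa using .infty) (by simpa using hu) (by simpa using hv))
    (fun x hx hx0 => by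
      have hdet : (0 : F) * 0 - 1 * 1 ≠ 0 := by simp
      have := QuadClosure.map hx (hP (moebiusPerm_mem_PGammaL2 hdet))
      simp only [moebiusPerm_apply, moebius] at this
      simpa [hx0] using
        this (by simpa using .zero) (by simpa using .infty) (by simpa using .one))
  have hmem : ∀ x, x ∈ L ↔ QuadClosure H A (some x) := fun x => by
    rw [← SetLike.mem_coe, hL]; rfl
  refine ⟨L, fun x hx => ((hmem x).mp hx).mem_subfield hP x rfl, ⟨l, (hmem l).mpr hl, hl0, hl1⟩,
    fun h hh e1 e2 e3 x hx => ?_⟩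
  have hx' := ((hmem x).mp hx).map hh (by rw [e1]; exact .infty) (by rw [e2]; exact .zero)
    (by rw [e3]; exact .one)
  obtain ⟨y, hy⟩ := Option.ne_none_iff_exists'.mp
    (fun h' => Option.some_ne_none x (h.injective (h'.trans e1.symm)))
  exact ⟨y, (hmem y).mpr (hy ▸ hx'), hy⟩

theorem mapsLines_of_stable (hP : PGammaL2 F ⊆ (H : Set (Equiv.Perm (Option F))))
    {L : Subfield F}
    (hL : ∀ h ∈ H, h none = none → h (some 0) = some 0 → h (some 1) = some 1 →
        ∀ x ∈ L, ∃ y ∈ L, h (some x) = some y)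
    {h : Equiv.Perm (Option F)} (hh : h ∈ H) (hn : h none = none) {f : F ≃ F}
    (hf : ∀ x, h (some x) = some (f x)) : MapsLines L f := by
  intro a b s hs
  by_cases hab : a = b
  · exact ⟨0, L.zero_mem, by simp [hab]⟩
  have hab' : f b - f a ≠ 0 := sub_ne_zero.mpr (f.injective.ne (Ne.symm hab))
  have hdet : (b - a) * 1 - a * 0 ≠ 0 := by simpa [sub_eq_zero, eq_comm] using hab
  have hdet' : (f b - f a)⁻¹ * 1 - (-(f b - f a)⁻¹ * f a) * 0 ≠ 0 := by simpa using hab'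
  obtain ⟨t, ht, h1⟩ := hL (moebiusPerm _ _ _ _ hdet' * h * moebiusPerm _ _ _ _ hdet)
    (H.mul_mem (H.mul_mem (hP (moebiusPerm_mem_PGammaL2 _)) hh) (hP (moebiusPerm_mem_PGammaL2 _)))
    (by simp [moebiusPerm_apply, moebius, hn]) (by simp [moebiusPerm_apply, moebius, hf])
    (by
      have : (f b - f a)⁻¹ * f b + -((f b - f a)⁻¹ * f a) = 1 := by field_simp; ring
      simp [moebiusPerm_apply, moebius, hf, this]) s hs
  refine ⟨t, ht, ?_⟩
  simp only [Equiv.Perm.coe_mul, Function.comp_apply, moebiusPerm_apply, moebius] at h1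
  simp only [RingEquiv.refl_apply, zero_mul, zero_add, one_ne_zero, if_false, div_one,
    Option.some.injEq, hf] at h1
  rw [← h1, add_comm a, mul_comm s]
  field_simp
  ring

/-- The elements of `H` fixing `∞`, `0` and `1` are field automorphisms. -/
theorem exists_ringEquiv_of_stable [IsAlgClosed F]
    (hP : PGammaL2 F ⊆ (H : Set (Equiv.Perm (Option F)))) {L : Subfield F}
    (hL : ∀ h ∈ H, h none = none → h (some 0) = some 0 → h (some 1) = some 1 →
        ∀ x ∈ L, ∃ y ∈ L, h (some x) = some y)
    {u : F} (hu : u ∈ L) (hu0 : u ≠ 0) (hu1 : u ≠ 1) {t : F} (ht : t ∉ L)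
    {h : Equiv.Perm (Option F)} (hh : h ∈ H) (hn : h none = none) (h0 : h (some 0) = some 0)
    (h1 : h (some 1) = some 1) : ∃ σ : F ≃+* F, ∀ x, h (some x) = some (σ x) := by
  have hadd : ∀ {h : Equiv.Perm (Option F)}, h ∈ H → h none = none → h (some 0) = some 0 →
      ∃ f : F ≃ F, (∀ x, h (some x) = some (f x)) ∧ ∀ x y, f (x + y) = f x + f y := by
    intro h hh hn h0
    obtain ⟨f, hf⟩ := exists_equiv_of_apply_none hn
    have hf' : ∀ x, h⁻¹ (some x) = some (f.symm x) := fun x => by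
      rw [Equiv.Perm.inv_eq_iff_eq, hf, Equiv.apply_symm_apply]
    refine ⟨f, hf, (mapsLines_of_stable hP hL hh hn hf).map_add
      (mapsLines_of_stable hP hL (H.inv_mem hh) (by rw [Equiv.Perm.inv_eq_iff_eq, hn]) hf')
      (by simpa [hf] using h0) hu hu0 hu1 ht⟩
  have hdet : (0 : F) * 0 - 1 * 1 ≠ 0 := by simp
  have hι : ∀ x : F, x ≠ 0 → moebiusPerm _ _ _ _ hdet (some x) = some x⁻¹ := fun x hx => by
    simp [moebiusPerm_apply, moebius, hx]
  have hιn : moebiusPerm _ _ _ _ hdet none = some 0 := by simp [moebiusPerm_apply, moebius]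
  have hι0 : moebiusPerm _ _ _ _ hdet (some 0) = none := by simp [moebiusPerm_apply, moebius]
  have hιH := hP (moebiusPerm_mem_PGammaL2 hdet)
  obtain ⟨f, hf, hfadd⟩ := hadd hh hn h0
  obtain ⟨g, hg, hgadd⟩ := hadd (H.mul_mem (H.mul_mem hιH hh) hιH)
    (by simp [hιn, hι0, h0]) (by simp [hιn, hι0, hn])
  have hf0 : f 0 = 0 := by simpa [hf] using h0
  have hf1 : f 1 = 1 := by simpa [hf] using h1
  have hfx : ∀ x, x ≠ 0 → f x ≠ 0 := fun x hx h' => hx (f.injective (h'.trans hf0.symm))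
  have hgf : ∀ x, g x = (f x⁻¹)⁻¹ := by
    intro x
    have := hg x
    by_cases hx : x = 0
    · simpa [hx, hι0, hιn, hn, hf0, eq_comm] using this
    · simpa [hι x hx, hf, hι _ (hfx _ (inv_ne_zero hx)), eq_comm] using this
  have hsq : ∀ x : F, ∃ y, y ^ 2 = x := fun x => IsAlgClosed.exists_pow_nat_eq x two_pos
  have hmul := map_mul_of_map_inv hsq hgadd hfadd hf1
    (fun x hx => by_contra fun h' => hfx x h' hx) (fun x => by rw [hgf, inv_inv])
  exact ⟨RingEquiv.mk f hmul hfadd, hf⟩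

theorem subset_PGammaL2_of_stable [IsAlgClosed F]
    (hP : PGammaL2 F ⊆ (H : Set (Equiv.Perm (Option F)))) {L : Subfield F}
    (hL : ∀ h ∈ H, h none = none → h (some 0) = some 0 → h (some 1) = some 1 →
        ∀ x ∈ L, ∃ y ∈ L, h (some x) = some y)
    {u : F} (hu : u ∈ L) (hu0 : u ≠ 0) (hu1 : u ≠ 1) {t : F} (ht : t ∉ L) :
    (H : Set (Equiv.Perm (Option F))) ⊆ PGammaL2 F := by
  intro h hh
  obtain ⟨a, b, c, d, hdet, e1, e2, e3⟩ := exists_moebiusPerm_apply_eq_of_ne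
    (x := h none) (y := h (some 0)) (z := h (some 1)) (by simp) (by simp) (by simp)
  set m := moebiusPerm a b c d hdet with hm
  have hn : (m⁻¹ * h) none = none := by simp [← e1]
  obtain ⟨σ, hσ⟩ := exists_ringEquiv_of_stable hP hL hu hu0 hu1 ht
    (H.mul_mem (H.inv_mem (hP (moebiusPerm_mem_PGammaL2 hdet))) hh) hn (by simp [← hm, ← e2])
    (by simp [← hm, ← e3])
  refine ⟨σ, a, b, c, d, hdet, fun x => ?_⟩
  rcases x with _ | x
  · exact e1.symm
  · have : h (some x) = m (some (σ x)) := by rw [← hσ]; simp [m]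
    exact this

end Closure

/-- If `F` is an algebraically closed field of transcendence degree at least `1` over
its prime field `(⊥ : Subfield F)`, then every group `H` of permutations of `F ∪ {∞}`
properly containing `PΓL₂(F)` is `4`-transitive. -/
theorem four_transitive_of_gt_PGammaL2 {F : Type*} [Field F] [IsAlgClosed F]
    (htr : ∃ x : F, Transcendental (⊥ : Subfield F) x)
    (H : Subgroup (Equiv.Perm (Option F)))
    (hH : PGammaL2 F ⊂ (H : Set (Equiv.Perm (Option F)))) :
    ∀ a b c d a' b' c' d' : Option F,
      a ≠ b → a ≠ c → a ≠ d → b ≠ c → b ≠ d → c ≠ d →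
      a' ≠ b' → a' ≠ c' → a' ≠ d' → b' ≠ c' → b' ≠ d' → c' ≠ d' →
      ∃ h ∈ H, h a = a' ∧ h b = b' ∧ h c = c' ∧ h d = d' := by
  have hP := hH.subset
  let A : Subfield F := (algebraicClosure (⊥ : Subfield F) F).toSubfield
  have hA : ∀ t : F, t ∉ A ↔ Transcendental (⊥ : Subfield F) t := fun t =>
    not_congr mem_algebraicClosure_iff
  obtain ⟨t, ht⟩ := htr
  have key : ∀ a b c d : Option F, a ≠ b → a ≠ c → a ≠ d → b ≠ c → b ≠ d → c ≠ d →
      ∃ h ∈ H, h a = none ∧ h b = some 0 ∧ h c = some 1 ∧ h d = some t := by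
    intro a b c d hab hac had hbc hbd hcd
    by_cases hq : OrbitIn H A a b c d
    · obtain ⟨L, hLA, ⟨u, hu, hu0, hu1⟩, hL⟩ := exists_stable_subfield hP hq had hbd hcd
      exact absurd (subset_PGammaL2_of_stable hP hL hu hu0 hu1
        (fun h => (hA t).mpr ht (hLA h))) hH.not_subset
    · simp only [OrbitIn, not_and, not_forall] at hq
      obtain ⟨h, hh, h1, h2, h3, s, h4, hs⟩ := hq hab hac hbc
      obtain ⟨σ, hσ⟩ := exists_ringEquiv_apply_eq_of_transcendental ((hA s).mp hs) ht
      exact ⟨Equiv.optionCongr σ.toEquiv * h, H.mul_mem (hP (optionCongr_mem_PGammaL2 σ)) hh,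
        by simp [h1], by simp [h2], by simp [h3], by simp [h4, hσ]⟩
  intro a b c d a' b' c' d' hab hac had hbc hbd hcd hab' hac' had' hbc' hbd' hcd'
  obtain ⟨g, hg, g1, g2, g3, g4⟩ := key a b c d hab hac had hbc hbd hcd
  obtain ⟨g', hg', g1', g2', g3', g4'⟩ := key a' b' c' d' hab' hac' had' hbc' hbd' hcd'
  refine ⟨g'⁻¹ * g, H.mul_mem (H.inv_mem hg') hg, ?_, ?_, ?_, ?_⟩ <;>
    rw [Equiv.Perm.mul_apply, Equiv.Perm.inv_eq_iff_eq]
  exacts [g1.trans g1'.symm, g2.trans g2'.symm, g3.trans g3'.symm, g4.trans g4'.symm]
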